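/- Under Assumption 1, for every horizon k ≥ 0 and every x_0 ∈ ℝ^n with x_0 ≥ 0, the infimum over admissible controls u(0),…,u(k−1) (with u(t) ∈ U(x(t)) and x(t+1) = Ax(t) + Bu(t), x(0) = x_0) of the finite-horizon cost Σ_{t=0}^{k−1} [s^T x(t) + r^T u(t)] is attained and equals (T^k(0))^T x_0, where T^k denotes the k-fold iterate of the Bellman operator T applied to the zero vector. -/

import Mathlib

open Matrix Finset

/-- `minZero v` is the minimum of the entries of `v` and of the scalar `0`. -/
noncomputable def minZero {k : ℕ} (v : Fin k → ℝ) : ℝ :=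
  (insert (0 : ℝ) (Finset.image v Finset.univ)).min' (Finset.insert_nonempty _ _)

/-- The Bellman operator `T(p) = s + Aᵀ p + Σ_i min{r_i + B_iᵀ p, 0} E_i`. -/
noncomputable def bellman {n : ℕ} {m : Fin n → ℕ}
    (A : Matrix (Fin n) (Fin n) ℝ) (B : ∀ i, Matrix (Fin n) (Fin (m i)) ℝ)
    (s : Fin n → ℝ) (r : ∀ i, Fin (m i) → ℝ) (E : Matrix (Fin n) (Fin n) ℝ)
    (p : Fin n → ℝ) : Fin n → ℝ :=
  fun j => s j + (Aᵀ *ᵥ p) j +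
    ∑ i, minZero (fun l => r i l + ((B i)ᵀ *ᵥ p) l) * E i j

/-- Membership in the set 𝒦 of blockwise nonnegative feedback matrices with
full (`1ᵀ K_i = E_iᵀ`) or zero (`1ᵀ K_i = 0`) actuation in each block. -/
def memK {n : ℕ} {m : Fin n → ℕ} (E : Matrix (Fin n) (Fin n) ℝ)
    (K : ∀ i, Matrix (Fin (m i)) (Fin n) ℝ) : Prop :=
  ∀ i, (∀ l j, 0 ≤ K i l j) ∧
    ((∀ j, ∑ l, K i l j = E i j) ∨ (∀ j, ∑ l, K i l j = 0))

/-- Assumption 1: `(A + BK) x ≥ 0` for every `K ∈ 𝒦` and every `x ≥ 0`. -/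
def assumption1 {n : ℕ} {m : Fin n → ℕ}
    (A : Matrix (Fin n) (Fin n) ℝ) (B : ∀ i, Matrix (Fin n) (Fin (m i)) ℝ)
    (E : Matrix (Fin n) (Fin n) ℝ) : Prop :=
  ∀ K : ∀ i, Matrix (Fin (m i)) (Fin n) ℝ, memK E K →
    ∀ x : Fin n → ℝ, 0 ≤ x → 0 ≤ (A + ∑ i, B i * K i) *ᵥ x

/-- The constraint set `U(x) = {u : u ≥ 0, 1ᵀ u_i ≤ E_iᵀ x for all i}`. -/
def inputSet {n : ℕ} {m : Fin n → ℕ} (E : Matrix (Fin n) (Fin n) ℝ)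
    (x : Fin n → ℝ) : Set (∀ i, Fin (m i) → ℝ) :=
  {u | ∀ i, (∀ l, 0 ≤ u i l) ∧ (∑ l, u i l) ≤ ∑ j, E i j * x j}

/-- An admissible trajectory from `x0`: `x(0) = x0`, `u(t) ∈ U(x(t))` and
`x(t+1) = A x(t) + B u(t)`. -/
def admissible {n : ℕ} {m : Fin n → ℕ}
    (A : Matrix (Fin n) (Fin n) ℝ) (B : ∀ i, Matrix (Fin n) (Fin (m i)) ℝ)
    (E : Matrix (Fin n) (Fin n) ℝ) (x0 : Fin n → ℝ)
    (x : ℕ → Fin n → ℝ) (u : ℕ → ∀ i, Fin (m i) → ℝ) : Prop :=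
  x 0 = x0 ∧ ∀ t, u t ∈ inputSet E (x t) ∧
    x (t + 1) = A *ᵥ x t + ∑ i, (B i) *ᵥ (u t i)

/-- The state trajectory generated by a control sequence `u` from `x0`. -/
noncomputable def traj {n : ℕ} {m : Fin n → ℕ}
    (A : Matrix (Fin n) (Fin n) ℝ) (B : ∀ i, Matrix (Fin n) (Fin (m i)) ℝ)
    (x0 : Fin n → ℝ) (u : ℕ → ∀ i, Fin (m i) → ℝ) : ℕ → Fin n → ℝ
  | 0 => x0
  | t + 1 => A *ᵥ traj A B x0 u t + ∑ i, (B i) *ᵥ (u t i)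

/-- Total cost `Σ_{t=0}^∞ [sᵀ x(t) + rᵀ u(t)] ∈ [0,∞]` of a trajectory. -/
noncomputable def trajCost {n : ℕ} {m : Fin n → ℕ}
    (s : Fin n → ℝ) (r : ∀ i, Fin (m i) → ℝ)
    (x : ℕ → Fin n → ℝ) (u : ℕ → ∀ i, Fin (m i) → ℝ) : ENNReal :=
  ∑' t, ENNReal.ofReal ((∑ j, s j * x t j) + ∑ i, ∑ l, r i l * u t i l)

/-- Optimal value `V(x0)`: infimum of the total cost over admissible trajectories. -/
noncomputable def optValue {n : ℕ} {m : Fin n → ℕ}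
    (A : Matrix (Fin n) (Fin n) ℝ) (B : ∀ i, Matrix (Fin n) (Fin (m i)) ℝ)
    (E : Matrix (Fin n) (Fin n) ℝ) (s : Fin n → ℝ) (r : ∀ i, Fin (m i) → ℝ)
    (x0 : Fin n → ℝ) : ENNReal :=
  ⨅ (x : ℕ → Fin n → ℝ) (u : ℕ → ∀ i, Fin (m i) → ℝ)
    (_ : admissible A B E x0 x u), trajCost s r x u

/-- The spectral radius of `M` is strictly less than `1`. -/
def schurStable {n : ℕ} (M : Matrix (Fin n) (Fin n) ℝ) : Prop :=
  ∀ μ ∈ spectrum ℂ (M.map Complex.ofReal), ‖μ‖ < 1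

theorem minZero_nonpos {k : ℕ} (v : Fin k → ℝ) : minZero v ≤ 0 :=
  Finset.min'_le _ _ (by simp)

theorem minZero_le {k : ℕ} (v : Fin k → ℝ) (l : Fin k) : minZero v ≤ v l :=
  Finset.min'_le _ _ (by simp)

/-- `minZero v` is a lower bound of `v` over the scaled simplex. -/
theorem minZero_mul_le {k : ℕ} (v w : Fin k → ℝ) (c : ℝ) (hw : ∀ l, 0 ≤ w l)
    (hc : ∑ l, w l ≤ c) : minZero v * c ≤ ∑ l, v l * w l :=
  calc minZero v * c ≤ minZero v * ∑ l, w l :=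
        mul_le_mul_of_nonpos_left hc (minZero_nonpos v)
    _ = ∑ l, minZero v * w l := Finset.mul_sum _ _ _
    _ ≤ ∑ l, v l * w l := Finset.sum_le_sum fun l _ =>
        mul_le_mul_of_nonneg_right (minZero_le v l) (hw l)

/-- `minZero v` is attained at a vertex of the simplex or at the origin. -/
theorem exists_weight_eq_minZero {k : ℕ} (v : Fin k → ℝ) :
    ∃ w : Fin k → ℝ, (∀ l, 0 ≤ w l) ∧ (∑ l, w l = 1 ∨ ∀ l, w l = 0) ∧
      ∑ l, v l * w l = minZero v := by
  have h : minZero v ∈ insert (0 : ℝ) (Finset.image v Finset.univ) := Finset.min'_mem _ _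
  rw [Finset.mem_insert, Finset.mem_image] at h
  rcases h with h | ⟨l, -, h⟩
  · exact ⟨0, by simp, by simp, by simp [h]⟩
  · refine ⟨Pi.single l 1, fun l' => ?_, Or.inl (by simp), by simpa [Pi.single_apply] using h⟩
    by_cases hl : l' = l <;> simp [hl]

section ControlSystem

variable {n : ℕ} {m : Fin n → ℕ}
  (A : Matrix (Fin n) (Fin n) ℝ) (B : ∀ i, Matrix (Fin n) (Fin (m i)) ℝ)
  (s : Fin n → ℝ) (r : ∀ i, Fin (m i) → ℝ) (E : Matrix (Fin n) (Fin n) ℝ)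

/-- Under Assumption 1 the nonnegative orthant is invariant under admissible inputs. -/
theorem next_state_nonneg (hE : ∀ i j, 0 ≤ E i j) (hA1 : assumption1 A B E)
    {x : Fin n → ℝ} (hx : 0 ≤ x) {u : ∀ i, Fin (m i) → ℝ} (hu : u ∈ inputSet E x) :
    0 ≤ A *ᵥ x + ∑ i, (B i) *ᵥ (u i) := by
  intro a
  choose w hw0 hw1 hwm using fun i => exists_weight_eq_minZero (B i a)
  have hK := hA1 (fun i => Matrix.of fun l j => w i l * E i j) (fun i => ⟨fun l j =>
    mul_nonneg (hw0 i l) (hE i j), (hw1 i).imp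
      (fun h j => by simp [← Finset.sum_mul, h]) (fun h j => by simp [h])⟩) x hx a
  have hrow : ∀ i, ((B i * Matrix.of fun l j => w i l * E i j) *ᵥ x) a =
      minZero (B i a) * ∑ j, E i j * x j := by
    intro i
    simp only [Matrix.mulVec, dotProduct, Matrix.mul_apply, Matrix.of_apply, ← hwm,
      Finset.mul_sum, Finset.sum_mul]
    exact Finset.sum_congr rfl fun j _ => Finset.sum_congr rfl fun l _ => by ring
  rw [Matrix.add_mulVec, Matrix.sum_mulVec, Pi.add_apply, Finset.sum_apply] at hK
  simp only [hrow] at hK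
  rw [Pi.add_apply, Finset.sum_apply]
  refine hK.trans (add_le_add_right (Finset.sum_le_sum fun i _ => ?_) _)
  exact minZero_mul_le _ _ _ (hu i).1 (hu i).2

theorem bellman_dot (p x : Fin n → ℝ) :
    ∑ j, bellman A B s r E p j * x j = ∑ j, s j * x j + p ⬝ᵥ (A *ᵥ x) +
      ∑ i, minZero (fun l => r i l + ((B i)ᵀ *ᵥ p) l) * ∑ j, E i j * x j := by
  simp only [bellman, add_mul, Finset.sum_add_distrib]
  congr 1
  · rw [Matrix.dotProduct_mulVec, ← Matrix.mulVec_transpose]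
    rfl
  · simp only [Finset.sum_mul, Finset.mul_sum]
    rw [Finset.sum_comm]
    simp only [mul_assoc]

theorem stage_cost_add_dot_next (p x : Fin n → ℝ) (u : ∀ i, Fin (m i) → ℝ) :
    ∑ j, s j * x j + ∑ i, ∑ l, r i l * u i l +
        ∑ j, p j * (A *ᵥ x + ∑ i, (B i) *ᵥ (u i)) j =
      ∑ j, s j * x j + p ⬝ᵥ (A *ᵥ x) +
        ∑ i, ∑ l, (r i l + ((B i)ᵀ *ᵥ p) l) * u i l := by
  have h : ∑ j, p j * (A *ᵥ x + ∑ i, (B i) *ᵥ (u i)) j =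
      p ⬝ᵥ (A *ᵥ x) + ∑ i, ((B i)ᵀ *ᵥ p) ⬝ᵥ u i := by
    change p ⬝ᵥ (A *ᵥ x + ∑ i, (B i) *ᵥ (u i)) = _
    rw [dotProduct_add, dotProduct_sum]
    simp only [Matrix.dotProduct_mulVec, Matrix.mulVec_transpose]
  rw [h]
  simp only [add_mul, Finset.sum_add_distrib, dotProduct]
  ring

theorem bellman_dot_le (p x : Fin n → ℝ) {u : ∀ i, Fin (m i) → ℝ} (hu : u ∈ inputSet E x) :
    ∑ j, bellman A B s r E p j * x j ≤ ∑ j, s j * x j + ∑ i, ∑ l, r i l * u i l +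
      ∑ j, p j * (A *ᵥ x + ∑ i, (B i) *ᵥ (u i)) j := by
  rw [bellman_dot, stage_cost_add_dot_next]
  gcongr with i
  exact minZero_mul_le _ _ _ (hu i).1 (hu i).2

theorem exists_input_bellman_dot_eq (hE : ∀ i j, 0 ≤ E i j) (p : Fin n → ℝ)
    {x : Fin n → ℝ} (hx : 0 ≤ x) :
    ∃ u ∈ inputSet (m := m) E x,
      ∑ j, bellman A B s r E p j * x j = ∑ j, s j * x j + ∑ i, ∑ l, r i l * u i l +
        ∑ j, p j * (A *ᵥ x + ∑ i, (B i) *ᵥ (u i)) j := by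
  choose w hw0 hw1 hwm using
    fun i => exists_weight_eq_minZero (fun l => r i l + ((B i)ᵀ *ᵥ p) l)
  have hc : ∀ i, 0 ≤ ∑ j, E i j * x j := fun i =>
    Finset.sum_nonneg fun j _ => mul_nonneg (hE i j) (hx j)
  refine ⟨fun i l => w i l * ∑ j, E i j * x j,
    fun i => ⟨fun l => mul_nonneg (hw0 i l) (hc i), ?_⟩, ?_⟩
  · rw [← Finset.sum_mul]
    refine mul_le_of_le_one_left (hc i) ?_
    rcases hw1 i with h | h
    · exact h.le
    · simp [h]
  · rw [bellman_dot, stage_cost_add_dot_next]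
    simp only [← mul_assoc, ← Finset.sum_mul, hwm]

theorem traj_succ_eq_traj_shift (x0 : Fin n → ℝ) (u : ℕ → ∀ i, Fin (m i) → ℝ) (t : ℕ) :
    traj A B x0 u (t + 1) =
      traj A B (A *ᵥ x0 + ∑ i, (B i) *ᵥ (u 0 i)) (fun t => u (t + 1)) t := by
  induction t with
  | zero => rfl
  | succ t ih =>
    rw [traj, ih]
    rfl

end ControlSystem

/-- under Assumption 1, the finite-horizon optimal cost over
admissible controls is attained and equals `(T^k(0))ᵀ x0`. -/
theorem stmt_2 {n : ℕ} {m : Fin n → ℕ}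
    (A : Matrix (Fin n) (Fin n) ℝ) (B : ∀ i, Matrix (Fin n) (Fin (m i)) ℝ)
    (s : Fin n → ℝ) (r : ∀ i, Fin (m i) → ℝ) (E : Matrix (Fin n) (Fin n) ℝ)
    (hs : ∀ j, 0 < s j) (hr : ∀ i l, 0 ≤ r i l)
    (hE : ∀ i j, 0 ≤ E i j) (hEinv : IsUnit E.det)
    (hA1 : assumption1 A B E)
    (k : ℕ) (x0 : Fin n → ℝ) (hx0 : 0 ≤ x0) :
    IsLeast {v : ℝ | ∃ u : ℕ → ∀ i, Fin (m i) → ℝ,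
        (∀ t < k, u t ∈ inputSet E (traj A B x0 u t)) ∧
        v = ∑ t ∈ Finset.range k,
          ((∑ j, s j * traj A B x0 u t j) + ∑ i, ∑ l, r i l * u t i l)}
      (∑ j, ((bellman A B s r E)^[k] 0) j * x0 j) := by
  induction k generalizing x0 with
  | zero => exact ⟨⟨0, by simp⟩, by rintro v ⟨u, -, rfl⟩; simp⟩
  | succ k ih =>
    rw [Function.iterate_succ_apply']
    set p := (bellman A B s r E)^[k] 0
    constructor
    · obtain ⟨u₀, hu₀, hopt⟩ := exists_input_bellman_dot_eq A B s r E hE p hx0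
      obtain ⟨⟨u, hu, hcost⟩, -⟩ := ih _ (next_state_nonneg A B E hE hA1 hx0 hu₀)
      refine ⟨fun t => Nat.casesOn t u₀ u, fun t ht => ?_, ?_⟩
      · cases t with
        | zero => exact hu₀
        | succ t =>
          rw [traj_succ_eq_traj_shift]
          exact hu t (Nat.lt_of_succ_lt_succ ht)
      · rw [hopt, hcost, Finset.sum_range_succ', add_comm]
        simp only [traj_succ_eq_traj_shift]
        rfl
    · rintro v ⟨u, hu, rfl⟩
      have hu₀ : u 0 ∈ inputSet E x0 := hu 0 k.succ_pos
      have hrest := (ih _ (next_state_nonneg A B E hE hA1 hx0 hu₀)).2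
        ⟨fun t => u (t + 1), fun t ht => by
          rw [← traj_succ_eq_traj_shift]
          exact hu (t + 1) (Nat.succ_lt_succ ht), rfl⟩
      refine (bellman_dot_le A B s r E p x0 hu₀).trans ?_
      rw [Finset.sum_range_succ', add_comm]
      simp only [traj_succ_eq_traj_shift]
      exact add_le_add hrest le_rfl
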